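/- arXiv:2604.20359 — 2 statements merged into one kernel-verified Lean document; each statement's English description precedes it below -/
import Mathlib

section
/- Let d ∈ ℕ, d ≥ 2, m > 0, γ ∈ (0, 1/2), and let Λ be a real d × d matrix with ΛᵀẼΛ = Ẽ and Λ₀₀ > 0 (an orthochronous Lorentz matrix). Then j(Λx) = j(x) for every x ∈ ℝ^d. -/
open MeasureTheory

/-- The symbol `j(τ,ξ) = (τ² − (|ξ|² + m²))^(−γ)` on the forward mass region,
`0` elsewhere, on `ℝ^d ≅ ℝ × ℝ^{d−1}` (coordinate `0` is `τ`). -/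
noncomputable def jmass (d : ℕ) [NeZero d] (m γ : ℝ)
    (x : EuclideanSpace ℝ (Fin d)) : ℝ :=
  if Real.sqrt ((∑ i ∈ Finset.univ.erase 0, x i ^ 2) + m ^ 2) < x 0 then
    (x 0 ^ 2 - ((∑ i ∈ Finset.univ.erase 0, x i ^ 2) + m ^ 2)) ^ (-γ)
  else 0

/-- The Minkowski metric matrix `Ẽ = diag(1, −1, …, −1)`. -/
def minkMatrix (d : ℕ) [NeZero d] : Matrix (Fin d) (Fin d) ℝ :=
  Matrix.diagonal fun i => if i = 0 then 1 else -1

/-- Action of a `d × d` real matrix on `ℝ^d`. -/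
noncomputable def matAct (d : ℕ) (Λ : Matrix (Fin d) (Fin d) ℝ)
    (x : EuclideanSpace ℝ (Fin d)) : EuclideanSpace ℝ (Fin d) :=
  (EuclideanSpace.equiv (Fin d) ℝ).symm (Λ.mulVec (EuclideanSpace.equiv (Fin d) ℝ x))

/-- The Minkowski quadratic form `τ² − |ξ|²`. -/
def minkForm (d : ℕ) [NeZero d] (v : Fin d → ℝ) : ℝ :=
  v 0 ^ 2 - ∑ i ∈ Finset.univ.erase 0, v i ^ 2

theorem minkForm_eq_dotProduct (d : ℕ) [NeZero d] (v : Fin d → ℝ) :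
    minkForm d v = v ⬝ᵥ (minkMatrix d).mulVec v := by
  simp only [minkForm, minkMatrix, dotProduct, Matrix.mulVec_diagonal]
  rw [← Finset.add_sum_erase _ _ (Finset.mem_univ (0 : Fin d)), sub_eq_add_neg,
    ← Finset.sum_neg_distrib]
  congr 1
  · simp [sq]
  · refine Finset.sum_congr rfl fun i hi => ?_
    rw [if_neg (Finset.ne_of_mem_erase hi)]
    ring

theorem minkForm_neg (d : ℕ) [NeZero d] (v : Fin d → ℝ) :
    minkForm d (-v) = minkForm d v := by
  simp [minkForm]

theorem minkMatrix_mul_self (d : ℕ) [NeZero d] : minkMatrix d * minkMatrix d = 1 := by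
  rw [minkMatrix, Matrix.diagonal_mul_diagonal, ← Matrix.diagonal_one]
  congr 1
  ext i
  split_ifs <;> norm_num

theorem minkForm_mulVec {d : ℕ} [NeZero d] {Λ : Matrix (Fin d) (Fin d) ℝ}
    (hΛ : Λ.transpose * minkMatrix d * Λ = minkMatrix d) (v : Fin d → ℝ) :
    minkForm d (Λ.mulVec v) = minkForm d v := by
  have h : v ⬝ᵥ (minkMatrix d).mulVec v
      = v ⬝ᵥ (Λ.transpose * minkMatrix d * Λ).mulVec v := by rw [hΛ]
  rw [minkForm_eq_dotProduct, minkForm_eq_dotProduct, h, ← Matrix.mulVec_mulVec,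
    ← Matrix.mulVec_mulVec, Matrix.dotProduct_mulVec v, Matrix.vecMul_transpose]

/-- The transpose of a Lorentz matrix is a Lorentz matrix. -/
theorem lorentz_transpose {d : ℕ} [NeZero d] {Λ : Matrix (Fin d) (Fin d) ℝ}
    (hΛ : Λ.transpose * minkMatrix d * Λ = minkMatrix d) :
    Λ * minkMatrix d * Λ.transpose = minkMatrix d := by
  have h : minkMatrix d * Λ.transpose * minkMatrix d * Λ = 1 := by
    rw [Matrix.mul_assoc (minkMatrix d), Matrix.mul_assoc (minkMatrix d), hΛ,
      minkMatrix_mul_self]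
  have h' : Λ * minkMatrix d * Λ.transpose * minkMatrix d = 1 := by
    simpa only [Matrix.mul_assoc] using mul_eq_one_comm.mp h
  calc Λ * minkMatrix d * Λ.transpose
      = Λ * minkMatrix d * Λ.transpose * minkMatrix d * minkMatrix d := by
        rw [Matrix.mul_assoc _ (minkMatrix d) (minkMatrix d), minkMatrix_mul_self,
          Matrix.mul_one]
    _ = minkMatrix d := by rw [h', Matrix.one_mul]

theorem minkForm_lorentz_row {d : ℕ} [NeZero d] {Λ : Matrix (Fin d) (Fin d) ℝ}
    (hΛ : Λ.transpose * minkMatrix d * Λ = minkMatrix d) : minkForm d (Λ 0) = 1 := by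
  have h : Λ 0 = Λ.transpose.mulVec (Pi.single 0 1) := by
    ext i
    simp
  rw [h, minkForm_mulVec (by simpa using lorentz_transpose hΛ), minkForm]
  rw [Finset.sum_eq_zero fun i hi => by simp [Finset.ne_of_mem_erase hi]]
  simp

/-- Two forward timelike vectors have positive Euclidean inner product. -/
theorem dotProduct_pos_of_timelike {d : ℕ} [NeZero d] {u v : Fin d → ℝ}
    (hu : 0 < minkForm d u) (hu0 : 0 < u 0) (hv : 0 < minkForm d v) (hv0 : 0 < v 0) :
    0 < u ⬝ᵥ v := by
  have hcs := Finset.sum_mul_sq_le_sq_mul_sq (Finset.univ.erase (0 : Fin d)) u v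
  rw [dotProduct, ← Finset.add_sum_erase _ _ (Finset.mem_univ (0 : Fin d))]
  have hlt : (∑ i ∈ Finset.univ.erase 0, u i ^ 2) * ∑ i ∈ Finset.univ.erase 0, v i ^ 2
      < u 0 ^ 2 * v 0 ^ 2 :=
    mul_lt_mul'' (sub_pos.mp hu) (sub_pos.mp hv)
      (Finset.sum_nonneg fun i _ => sq_nonneg _) (Finset.sum_nonneg fun i _ => sq_nonneg _)
  have habs := abs_lt_of_sq_lt_sq (hcs.trans_lt (hlt.trans_eq (mul_pow _ _ 2).symm))
    (mul_pos hu0 hv0).le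
  linarith [(abs_lt.mp habs).1]

theorem lorentz_mulVec_zero_pos_iff {d : ℕ} [NeZero d] {Λ : Matrix (Fin d) (Fin d) ℝ}
    (hΛ : Λ.transpose * minkMatrix d * Λ = minkMatrix d) (hor : 0 < Λ 0 0)
    {v : Fin d → ℝ} (hv : 0 < minkForm d v) : 0 < Λ.mulVec v 0 ↔ 0 < v 0 := by
  have hrow : 0 < minkForm d (Λ 0) := by
    rw [minkForm_lorentz_row hΛ]
    exact one_pos
  refine ⟨fun h => ?_, dotProduct_pos_of_timelike hrow hor hv⟩
  by_contra! hneg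
  have hne : v 0 ≠ 0 := by
    intro h0
    have hsum : 0 ≤ ∑ i ∈ Finset.univ.erase 0, v i ^ 2 :=
      Finset.sum_nonneg fun i _ => sq_nonneg _
    rw [minkForm, h0] at hv
    linarith
  have hpos := dotProduct_pos_of_timelike hrow hor
    (v := -v) (by rwa [minkForm_neg]) (neg_pos.mpr (lt_of_le_of_ne hneg hne))
  rw [dotProduct_neg] at hpos
  exact (neg_pos.mp hpos).not_gt h

theorem jmass_eq_minkForm (d : ℕ) [NeZero d] (m γ : ℝ) (x : EuclideanSpace ℝ (Fin d)) :
    jmass d m γ x = if m ^ 2 < minkForm d x ∧ 0 < x 0 then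
      (minkForm d x - m ^ 2) ^ (-γ) else 0 := by
  have hiff : Real.sqrt ((∑ i ∈ Finset.univ.erase 0, x i ^ 2) + m ^ 2) < x 0 ↔
      m ^ 2 < minkForm d x ∧ 0 < x 0 := by
    rw [minkForm, lt_sub_iff_add_lt']
    refine ⟨fun h => ?_, fun h => (Real.sqrt_lt' h.2).mpr h.1⟩
    have h0 := (Real.sqrt_nonneg _).trans_lt h
    exact ⟨(Real.sqrt_lt' h0).mp h, h0⟩
  rw [jmass, minkForm, sub_sub]
  exact if_congr hiff rfl rfl

theorem stmt_3 (d : ℕ) [NeZero d] (hd : 2 ≤ d) (m γ : ℝ) (hm : 0 < m)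
    (hγ : γ ∈ Set.Ioo (0 : ℝ) (1 / 2)) (Λ : Matrix (Fin d) (Fin d) ℝ)
    (hΛ : Λ.transpose * minkMatrix d * Λ = minkMatrix d) (hor : 0 < Λ 0 0) :
    ∀ x : EuclideanSpace ℝ (Fin d), jmass d m γ (matAct d Λ x) = jmass d m γ x := by
  intro x
  have hQ : minkForm d (matAct d Λ x) = minkForm d x := minkForm_mulVec hΛ x
  rw [jmass_eq_minkForm, jmass_eq_minkForm, hQ]
  refine if_congr (and_congr_right fun h => ?_) rfl rfl
  exact lorentz_mulVec_zero_pos_iff hΛ hor ((pow_pos hm 2).trans h)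
end

section
/- Let d ∈ ℕ, d ≥ 2, m > 0, γ ∈ (0, 1/2), and let f ∈ 𝒮(ℝ^d, ℂ). Then for every n ∈ ℕ, ∫_{ℝ^d} (1 + |ζ|²)^n |j(ζ)|² |f̂(ζ)|² dζ < ∞; that is, j·f̂ belongs to every weighted L² space with polynomial weight (equivalently, 𝓕⁻¹(j·f̂) lies in the Sobolev space H^n(ℝ^d) for every n). -/
open MeasureTheory FourierTransform

/-- A function `g(τ - ω(ξ)) h(ξ)` is integrable on the product as soon as `g` and `h` are. -/
theorem integrable_sheared_mul {β : Type*} [MeasurableSpace β] {ν : Measure β} [SFinite ν]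
    {g : ℝ → ℝ} {h ω : β → ℝ} (hg : Integrable g) (hgm : Measurable g)
    (hh : Integrable h ν) (hhm : Measurable h) (hω : Measurable ω) :
    Integrable (fun p : ℝ × β => g (p.1 - ω p.2) * h p.2) (volume.prod ν) := by
  have hm : Measurable fun p : ℝ × β => g (p.1 - ω p.2) * h p.2 := by fun_prop
  refine (integrable_prod_iff' hm.aestronglyMeasurable).2 ⟨?_, ?_⟩
  · exact .of_forall fun y => (hg.comp_sub_right (ω y)).mul_const (h y)
  · simp only [norm_mul, integral_mul_const]
    have (y : β) : ∫ x, ‖g (x - ω y)‖ = ∫ x, ‖g x‖ :=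
      integral_sub_right_eq_self (fun x => ‖g x‖) (ω y)
    simp only [this]
    exact hh.norm.const_mul _

theorem measurePreserving_head_tail (k : ℕ) :
    MeasurePreserving (fun x : EuclideanSpace ℝ (Fin (k + 1)) =>
      ((x 0, fun i : Fin k => x i.succ) : ℝ × (Fin k → ℝ))) :=
  (volume_preserving_piFinSuccAbove (fun _ : Fin (k + 1) => ℝ) 0).comp
    (PiLp.volume_preserving_ofLp (Fin (k + 1)))

theorem measurable_jmass (d : ℕ) [NeZero d] (m γ : ℝ) : Measurable (jmass d m γ) := by
  unfold jmass
  refine Measurable.ite (measurableSet_lt ?_ ?_) ?_ measurable_const <;> fun_prop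

theorem sum_erase_zero {k : ℕ} (a : Fin (k + 1) → ℝ) :
    ∑ i ∈ Finset.univ.erase 0, a i = ∑ i : Fin k, a i.succ := by
  have h := Finset.add_sum_erase Finset.univ a (Finset.mem_univ 0)
  rw [Fin.sum_univ_succ] at h
  exact add_left_cancel h

/-- Near the mass shell `τ = ω(ξ)` the squared symbol has the integrable singularity
`(τ - ω(ξ))^(-2γ)`; away from it, the squared symbol is bounded. -/
theorem jmass_sq_le {k : ℕ} {m γ : ℝ} (hm : 0 < m) (hγ : 0 < γ)
    (x : EuclideanSpace ℝ (Fin (k + 1))) :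
    jmass (k + 1) m γ x ^ 2 ≤ m ^ (-(2 * γ)) *
      ((Set.Ioo (0 : ℝ) 1).indicator (fun t => t ^ (-(2 * γ)))
        (x 0 - Real.sqrt ((∑ i : Fin k, x i.succ ^ 2) + m ^ 2)) + 1) := by
  have hind (t : ℝ) : 0 ≤ (Set.Ioo (0 : ℝ) 1).indicator (fun t => t ^ (-(2 * γ))) t :=
    Set.indicator_nonneg (fun t ht => Real.rpow_nonneg ht.1.le _) t
  unfold jmass
  rw [sum_erase_zero (fun i => x i ^ 2)]
  have hS : 0 ≤ ∑ i : Fin k, x i.succ ^ 2 := by positivity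
  generalize ∑ i : Fin k, x i.succ ^ 2 = S at *
  have hω : Real.sqrt (S + m ^ 2) ^ 2 = S + m ^ 2 := Real.sq_sqrt (by positivity)
  have hmω : m ≤ Real.sqrt (S + m ^ 2) := Real.le_sqrt_of_sq_le (by linarith)
  generalize Real.sqrt (S + m ^ 2) = ω at *
  rw [← hω]
  split_ifs with h
  · have hlow : m * (x 0 - ω) ≤ x 0 ^ 2 - ω ^ 2 := by nlinarith
    have hpos : 0 < m * (x 0 - ω) := mul_pos hm (by linarith)
    have hsq : ((x 0 ^ 2 - ω ^ 2) ^ (-γ)) ^ 2 = (x 0 ^ 2 - ω ^ 2) ^ (-(2 * γ)) := by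
      rw [← Real.rpow_natCast, ← Real.rpow_mul (hpos.le.trans hlow)]
      congr 1
      push_cast
      ring
    rw [hsq]
    calc (x 0 ^ 2 - ω ^ 2) ^ (-(2 * γ)) ≤ (m * (x 0 - ω)) ^ (-(2 * γ)) :=
          Real.rpow_le_rpow_of_nonpos hpos hlow (by linarith)
      _ = m ^ (-(2 * γ)) * (x 0 - ω) ^ (-(2 * γ)) := Real.mul_rpow hm.le (by linarith)
      _ ≤ _ := by
        gcongr
        by_cases h1 : x 0 - ω < 1
        · rw [Set.indicator_of_mem (show x 0 - ω ∈ Set.Ioo 0 1 from ⟨by linarith, h1⟩)]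
          linarith
        · have := hind (x 0 - ω)
          have := Real.rpow_le_one_of_one_le_of_nonpos (not_lt.1 h1)
            (show -(2 * γ) ≤ 0 by linarith)
          linarith
  · have := hind (x 0 - ω)
    have := Real.rpow_pos_of_pos hm (-(2 * γ))
    rw [zero_pow two_ne_zero]
    positivity

/-- Rapid decay of the square of a Schwartz function, with an extra polynomial weight. -/
theorem SchwartzMap.exists_weight_mul_norm_sq_le {E F : Type*} [NormedAddCommGroup E]
    [NormedSpace ℝ E] [NormedAddCommGroup F] [NormedSpace ℝ F] (g : SchwartzMap E F) (n r : ℕ) :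
    ∃ C : ℝ, 0 ≤ C ∧
      ∀ x, (1 + ‖x‖ ^ 2) ^ n * ‖g x‖ ^ 2 ≤ C * (1 + ‖x‖) ^ (-(r : ℝ)) := by
  have hdecay (N : ℕ) : ∃ C : ℝ, ∀ x, (1 + ‖x‖) ^ N * ‖g x‖ ≤ C := ⟨_, fun x => by
    simpa using SchwartzMap.one_add_le_sup_seminorm_apply (𝕜 := ℝ) (m := (N, 0))
      (le_refl N) (le_refl 0) g x⟩
  obtain ⟨A, hA⟩ := hdecay (2 * n + r)
  obtain ⟨B, hB⟩ := hdecay 0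
  have hA0 : 0 ≤ A := le_trans (by positivity) (hA 0)
  have hB0 : 0 ≤ B := le_trans (by positivity) (hB 0)
  refine ⟨A * B, mul_nonneg hA0 hB0, fun x => ?_⟩
  have hx : 0 < 1 + ‖x‖ := by positivity
  rw [Real.rpow_neg hx.le, Real.rpow_natCast, ← div_eq_mul_inv, le_div_iff₀ (by positivity)]
  calc (1 + ‖x‖ ^ 2) ^ n * ‖g x‖ ^ 2 * (1 + ‖x‖) ^ r
      ≤ ((1 + ‖x‖) ^ 2) ^ n * ‖g x‖ ^ 2 * (1 + ‖x‖) ^ r := by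
        gcongr
        nlinarith [norm_nonneg x]
    _ = ((1 + ‖x‖) ^ (2 * n + r) * ‖g x‖) * ((1 + ‖x‖) ^ 0 * ‖g x‖) := by
        rw [← pow_mul]
        ring
    _ ≤ A * B := mul_le_mul (hA x) (hB x) (by positivity) hA0

theorem norm_tail_le {k : ℕ} (x : EuclideanSpace ℝ (Fin (k + 1))) :
    ‖fun i : Fin k => x i.succ‖ ≤ ‖x‖ :=
  (pi_norm_le_iff_of_nonneg (norm_nonneg x)).2 fun i => PiLp.norm_apply_le x i.succ

theorem integrable_weight_mul_jmass_sq (k : ℕ) {m γ : ℝ} (hm : 0 < m)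
    (hγ : γ ∈ Set.Ioo (0 : ℝ) (1 / 2))
    (g : SchwartzMap (EuclideanSpace ℝ (Fin (k + 1))) ℂ) (n : ℕ) :
    Integrable fun x : EuclideanSpace ℝ (Fin (k + 1)) =>
      (1 + ‖x‖ ^ 2) ^ n * (jmass (k + 1) m γ x ^ 2 * ‖g x‖ ^ 2) := by
  obtain ⟨C, hC0, hC⟩ := g.exists_weight_mul_norm_sq_le n (k + 2)
  set s : ℝ → ℝ := (Set.Ioo (0 : ℝ) 1).indicator (fun t => t ^ (-(2 * γ)))
  have hs0 (t : ℝ) : 0 ≤ s t :=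
    Set.indicator_nonneg (fun t ht => Real.rpow_nonneg ht.1.le _) t
  have hsm : Measurable s := (by fun_prop : Measurable fun t : ℝ => t ^ (-(2 * γ))).indicator
    measurableSet_Ioo
  have hsi : Integrable s := (integrable_indicator_iff measurableSet_Ioo).2
    ((intervalIntegral.integrableOn_Ioo_rpow_iff one_pos).2 (by linarith [hγ.2]))
  have hsing : Integrable fun x : EuclideanSpace ℝ (Fin (k + 1)) =>
      s (x 0 - Real.sqrt ((∑ i : Fin k, x i.succ ^ 2) + m ^ 2)) *
        (1 + ‖fun i : Fin k => x i.succ‖) ^ (-((k + 2 : ℕ) : ℝ)) :=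
    (measurePreserving_head_tail k).integrable_comp_of_integrable
      (g := fun p : ℝ × (Fin k → ℝ) => s (p.1 - Real.sqrt ((∑ i : Fin k, p.2 i ^ 2) + m ^ 2)) *
        (1 + ‖p.2‖) ^ (-((k + 2 : ℕ) : ℝ)))
      (integrable_sheared_mul
        (h := fun y : Fin k → ℝ => (1 + ‖y‖) ^ (-((k + 2 : ℕ) : ℝ)))
        (ω := fun y : Fin k → ℝ => Real.sqrt ((∑ i : Fin k, y i ^ 2) + m ^ 2)) hsi hsm
        (integrable_one_add_norm (by simp)) (by fun_prop) (by fun_prop))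
  have hreg : Integrable fun x : EuclideanSpace ℝ (Fin (k + 1)) =>
      (1 + ‖x‖) ^ (-((k + 2 : ℕ) : ℝ)) := integrable_one_add_norm (by simp)
  have hj := measurable_jmass (k + 1) m γ
  have hgm := g.continuous.measurable
  refine ((hsing.add hreg).const_mul (m ^ (-(2 * γ)) * C)).mono'
    (Measurable.aestronglyMeasurable (by fun_prop)) (.of_forall fun x => ?_)
  rw [Real.norm_of_nonneg (by positivity), Pi.add_apply]
  set t := x 0 - Real.sqrt ((∑ i : Fin k, x i.succ ^ 2) + m ^ 2)
  have hst := hs0 t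
  have htail : (1 + ‖x‖) ^ (-((k + 2 : ℕ) : ℝ)) ≤
      (1 + ‖fun i : Fin k => x i.succ‖) ^ (-((k + 2 : ℕ) : ℝ)) :=
    Real.rpow_le_rpow_of_nonpos (by positivity) (by gcongr; exact norm_tail_le x)
      (neg_nonpos.2 (Nat.cast_nonneg _))
  calc (1 + ‖x‖ ^ 2) ^ n * (jmass (k + 1) m γ x ^ 2 * ‖g x‖ ^ 2)
      = jmass (k + 1) m γ x ^ 2 * ((1 + ‖x‖ ^ 2) ^ n * ‖g x‖ ^ 2) := by ring
    _ ≤ (m ^ (-(2 * γ)) * (s t + 1)) * (C * (1 + ‖x‖) ^ (-((k + 2 : ℕ) : ℝ))) :=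
        mul_le_mul (jmass_sq_le hm hγ.1 x) (hC x) (by positivity) (by positivity)
    _ = m ^ (-(2 * γ)) * C * (s t * (1 + ‖x‖) ^ (-((k + 2 : ℕ) : ℝ)) +
          (1 + ‖x‖) ^ (-((k + 2 : ℕ) : ℝ))) := by ring
    _ ≤ _ := by gcongr

theorem stmt_8 (d : ℕ) [NeZero d] (hd : 2 ≤ d) (m γ : ℝ) (hm : 0 < m)
    (hγ : γ ∈ Set.Ioo (0 : ℝ) (1 / 2))
    (f : SchwartzMap (EuclideanSpace ℝ (Fin d)) ℂ) :
    ∀ n : ℕ,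
      Integrable
        (fun ζ : EuclideanSpace ℝ (Fin d) =>
          (1 + ‖ζ‖ ^ 2) ^ n * (jmass d m γ ζ ^ 2 * ‖𝓕 (⇑f) ζ‖ ^ 2)) volume := by
  intro n
  obtain ⟨k, rfl⟩ := Nat.exists_eq_succ_of_ne_zero (NeZero.ne d)
  exact integrable_weight_mul_jmass_sq k hm hγ (𝓕 f) n
end
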